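/- arXiv:math-ph/0206002 — 7 statements merged into one kernel-verified Lean document; each statement's English description precedes it below -/
import Mathlib

section
/- Let n ≥ 1 and let a_1, …, a_{n+1}, a be n+2 real numbers such that (a_1 + a_2 + ⋯ + a_{n+1})² = n·(a_1² + a_2² + ⋯ + a_{n+1}² + a). Then 2·a_1·a_2 ≥ a. -/
/-- Chen's algebraic lemma (inequality part): if `a₁, …, a_{n+1}, a` are `n+2` real
numbers (`n ≥ 1`) such that `(a₁ + ⋯ + a_{n+1})² = n (a₁² + ⋯ + a_{n+1}² + a)`,
then `2 a₁ a₂ ≥ a`. -/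
theorem chen_lemma_inequality (n : ℕ) (hn : 1 ≤ n) (a : Fin (n + 1) → ℝ) (b : ℝ)
    (h : (∑ i, a i) ^ 2 = n * ((∑ i, (a i) ^ 2) + b)) :
    2 * a 0 * a 1 ≥ b := by
  obtain ⟨m, rfl⟩ : ∃ m, n = m + 1 := ⟨n - 1, by omega⟩
  have hc := sq_sum_le_card_mul_sum_sq (s := (Finset.univ : Finset (Fin (m + 1))))
    (f := Fin.cons (a 0 + a 1) (fun i : Fin m => a i.succ.succ))
  simp only [Fin.sum_univ_succ, Fin.cons_zero, Fin.cons_succ, Finset.card_univ,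
    Fintype.card_fin, Fin.succ_zero_eq_one] at hc h
  rw [← add_assoc] at h
  rw [h] at hc
  have hpos : (0 : ℝ) < ((m + 1 : ℕ) : ℝ) := by positivity
  have := le_of_mul_le_mul_left hc hpos
  nlinarith
end

section
/- Let n ≥ 1 and let a_1, …, a_{n+1}, a be n+2 real numbers such that (a_1 + a_2 + ⋯ + a_{n+1})² = n·(a_1² + a_2² + ⋯ + a_{n+1}² + a). Then 2·a_1·a_2 = a if and only if a_1 + a_2 = a_3 = a_4 = ⋯ = a_{n+1}. -/
/-- Chen's algebraic lemma (equality part): if `a₁, …, a_{n+1}, a` are `n+2` real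
numbers (`n ≥ 1`) such that `(a₁ + ⋯ + a_{n+1})² = n (a₁² + ⋯ + a_{n+1}² + a)`,
then `2 a₁ a₂ = a` if and only if `a₁ + a₂ = a₃ = ⋯ = a_{n+1}`. -/
theorem chen_lemma_equality (n : ℕ) (hn : 1 ≤ n) (a : Fin (n + 1) → ℝ) (b : ℝ)
    (h : (∑ i, a i) ^ 2 = n * ((∑ i, (a i) ^ 2) + b)) :
    2 * a 0 * a 1 = b ↔ ∀ j : Fin (n + 1), 2 ≤ (j : ℕ) → a 0 + a 1 = a j := by
  obtain ⟨m, rfl⟩ : ∃ m, n = m + 1 := ⟨n - 1, by omega⟩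
  rw [Fin.sum_univ_succ, Fin.sum_univ_succ, Fin.sum_univ_succ (fun i => a i ^ 2),
    Fin.sum_univ_succ (fun i : Fin (m + 1) => a i.succ ^ 2)] at h
  rw [show (Fin.succ (0 : Fin (m + 1))) = 1 from rfl] at h
  push_cast at h
  have hm : (0 : ℝ) < (m : ℝ) + 1 := by positivity
  constructor
  · intro hb
    obtain ⟨M, hM⟩ : ∃ M : ℝ, ((m : ℝ) + 1) * M = a 0 + a 1 + ∑ i : Fin m, a i.succ.succ :=
      ⟨(a 0 + a 1 + ∑ i : Fin m, a i.succ.succ) / (m + 1), by field_simp⟩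
    have hexp : ∑ i : Fin m, (a i.succ.succ - M) ^ 2
        = ∑ i : Fin m, a i.succ.succ ^ 2 - 2 * M * ∑ i : Fin m, a i.succ.succ + m * M ^ 2 := by
      simp only [sub_sq, Finset.sum_add_distrib, Finset.sum_sub_distrib, Finset.mul_sum]
      simp only [Finset.sum_const, Finset.card_univ, Fintype.card_fin, nsmul_eq_mul]
      congr 2
      exact Finset.sum_congr rfl fun i _ => by ring
    have hnn : ∀ i ∈ Finset.univ, 0 ≤ (a (Fin.succ (Fin.succ (i : Fin m))) - M) ^ 2 :=
      fun i _ => sq_nonneg _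
    have hS := Finset.sum_nonneg hnn
    generalize hX : ∑ i : Fin m, a i.succ.succ = X at *
    generalize hQ : ∑ i : Fin m, a i.succ.succ ^ 2 = Q at *
    have hX' : X = (m + 1) * M - a 0 - a 1 := by linarith
    have key : (a 0 + a 1) ^ 2 + Q = ((m : ℝ) + 1) * M ^ 2 := by
      apply mul_left_cancel₀ hm.ne'
      subst hb
      subst hX'
      linear_combination -h
    have hz : (a 0 + a 1 - M) ^ 2 + ∑ i : Fin m, (a i.succ.succ - M) ^ 2 = 0 := by
      rw [hexp, hX']
      linear_combination key
    have h1 : (a 0 + a 1 - M) ^ 2 = 0 := by nlinarith [sq_nonneg (a 0 + a 1 - M)]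
    have h2 : ∑ i : Fin m, (a i.succ.succ - M) ^ 2 = 0 := by linarith
    rw [Finset.sum_eq_zero_iff_of_nonneg hnn] at h2
    have h1' := pow_eq_zero_iff (two_ne_zero) |>.1 h1
    intro j hj
    obtain ⟨i, rfl⟩ : ∃ i : Fin m, j = i.succ.succ :=
      ⟨⟨j - 2, by omega⟩, by ext; simp; omega⟩
    have h3 := pow_eq_zero_iff (two_ne_zero) |>.1 (h2 i (Finset.mem_univ _))
    linarith
  · intro hj
    have hx : ∀ i : Fin m, a i.succ.succ = a 0 + a 1 := fun i => (hj _ (by simp)).symm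
    simp only [hx, Finset.sum_const, Finset.card_univ, Fintype.card_fin, nsmul_eq_mul] at h
    apply mul_left_cancel₀ hm.ne'
    linear_combination h
end

section
/- Let n ≥ 2 and k ≥ 1 be integers. For each r = 1, …, k let h^r = (h^r_{ij})_{1 ≤ i,j ≤ n+1} be a symmetric real (n+1)×(n+1) matrix, and let ρ be a real number such that (Σ_{i=1}^{n+1} h^1_{ii})² = n·( Σ_{r=1}^{k} Σ_{i,j=1}^{n+1} (h^r_{ij})² + ρ ). Then Σ_{r=1}^{k} ( h^r_{11}·h^r_{22} − (h^r_{12})² ) ≥ ρ/2. -/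
lemma core_aux (m : ℕ) (A : Matrix (Fin (m + 2)) (Fin (m + 2)) ℝ) (hA : A.IsSymm) :
    (∑ i, A i i) ^ 2 ≤
      ((m + 1 : ℕ) : ℝ) * ((∑ i, ∑ j, (A i j) ^ 2) + 2 * (A 0 0 * A 1 1 - (A 0 1) ^ 2)) := by
  have hs : A 1 0 = A 0 1 := hA.apply 0 1
  have h0 : A 0 0 ^ 2 + A 0 1 ^ 2 ≤ ∑ j, (A 0 j) ^ 2 := by
    rw [Fin.sum_univ_succ, Fin.sum_univ_succ]
    have : 0 ≤ ∑ i : Fin m, A 0 i.succ.succ ^ 2 := Finset.sum_nonneg fun _ _ => sq_nonneg _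
    simp only [Fin.succ_zero_eq_one]
    linarith
  have h1 : A 0 1 ^ 2 + A 1 1 ^ 2 ≤ ∑ j, (A 1 j) ^ 2 := by
    rw [Fin.sum_univ_succ, Fin.sum_univ_succ]
    have : 0 ≤ ∑ i : Fin m, A 1 i.succ.succ ^ 2 := Finset.sum_nonneg fun _ _ => sq_nonneg _
    simp only [Fin.succ_zero_eq_one, hs]
    linarith
  have h2 : ∑ i : Fin m, A i.succ.succ i.succ.succ ^ 2 ≤
      ∑ i : Fin m, ∑ j, A i.succ.succ j ^ 2 :=
    Finset.sum_le_sum fun i _ =>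
      Finset.single_le_sum (f := fun j => A i.succ.succ j ^ 2)
        (fun _ _ => sq_nonneg _) (Finset.mem_univ i.succ.succ)
  have hc := sq_sum_le_card_mul_sum_sq (s := (Finset.univ : Finset (Fin (m + 1))))
    (f := (Fin.cons (A 0 0 + A 1 1) (fun i : Fin m => A i.succ.succ i.succ.succ) :
      Fin (m + 1) → ℝ))
  rw [Fin.sum_univ_succ, Fin.sum_univ_succ] at hc
  simp only [Fin.cons_zero, Fin.cons_succ, Finset.card_univ, Fintype.card_fin] at hc
  rw [Fin.sum_univ_succ (f := fun i => A i i),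
    Fin.sum_univ_succ (f := fun i : Fin (m + 1) => A i.succ i.succ),
    Fin.sum_univ_succ (f := fun i => ∑ j, A i j ^ 2),
    Fin.sum_univ_succ (f := fun i : Fin (m + 1) => ∑ j, A i.succ j ^ 2)]
  simp only [Fin.succ_zero_eq_one]
  rw [← add_assoc]
  refine hc.trans (mul_le_mul_of_nonneg_left ?_ (Nat.cast_nonneg _))
  nlinarith

/-- Algebraic core of the basic inequality: for symmetric real `(n+1)×(n+1)`
matrices `h¹, …, hᵏ` (`n ≥ 2`, `k ≥ 1`) and a real number `ρ` with
`(∑ᵢ h¹ᵢᵢ)² = n (∑ᵣ ∑ᵢⱼ (hʳᵢⱼ)² + ρ)`, one has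
`∑ᵣ (hʳ₁₁ hʳ₂₂ − (hʳ₁₂)²) ≥ ρ / 2`. -/
theorem basic_inequality_algebraic_core (n k : ℕ) (hn : 2 ≤ n) (hk : 1 ≤ k)
    (h : Fin k → Matrix (Fin (n + 1)) (Fin (n + 1)) ℝ)
    (hsymm : ∀ r, (h r).IsSymm) (ρ : ℝ)
    (htrace : (∑ i, h ⟨0, hk⟩ i i) ^ 2 =
      n * ((∑ r, ∑ i, ∑ j, (h r i j) ^ 2) + ρ)) :
    ∑ r, (h r 0 0 * h r 1 1 - (h r 0 1) ^ 2) ≥ ρ / 2 := by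
  obtain ⟨m, rfl⟩ : ∃ m, n = m + 1 := ⟨n - 1, by omega⟩
  have hpos : (0 : ℝ) < ((m + 1 : ℕ) : ℝ) := by positivity
  have key : ∀ r, (∑ i, h r i i) ^ 2 ≤ ((m + 1 : ℕ) : ℝ) *
      ((∑ i, ∑ j, (h r i j) ^ 2) + 2 * (h r 0 0 * h r 1 1 - (h r 0 1) ^ 2)) :=
    fun r => core_aux m (h r) (hsymm r)
  have h1 : (∑ i, h ⟨0, hk⟩ i i) ^ 2 ≤ ∑ r, (∑ i, h r i i) ^ 2 :=
    Finset.single_le_sum (f := fun r => (∑ i, h r i i) ^ 2)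
      (fun _ _ => sq_nonneg _) (Finset.mem_univ (⟨0, hk⟩ : Fin k))
  have h2 := h1.trans (Finset.sum_le_sum fun r _ => key r)
  rw [htrace, ← Finset.mul_sum, Finset.sum_add_distrib, ← Finset.mul_sum] at h2
  have h3 := le_of_mul_le_mul_left h2 hpos
  linarith
end

section
/- Let n ≥ 2 and k ≥ 1 be integers. For each r = 1, …, k let h^r = (h^r_{ij})_{1 ≤ i,j ≤ n+1} be a symmetric real (n+1)×(n+1) matrix, and let ρ be a real number such that (Σ_{i=1}^{n+1} h^1_{ii})² = n·( Σ_{r=1}^{k} Σ_{i,j=1}^{n+1} (h^r_{ij})² + ρ ). Then equality Σ_{r=1}^{k} ( h^r_{11}·h^r_{22} − (h^r_{12})² ) = ρ/2 holds if and only if all of the following hold: (i) h^1_{11} + h^1_{22} = h^1_{jj} for every j with 3 ≤ j ≤ n+1; (ii) h^1_{ij} = 0 for all i < j with (i,j) ≠ (1,2); (iii) for every r with 2 ≤ r ≤ k, h^r_{11} + h^r_{22} = 0 and h^r_{ij} = 0 whenever i ≥ 3 or j ≥ 3. -/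
/-- Sum of the squares of the entries off the diagonal and off the top-left block. -/
noncomputable def offPart {m : ℕ} (A : Matrix (Fin (m + 2)) (Fin (m + 2)) ℝ) : ℝ :=
  ∑ i : Fin (m + 2), ∑ j : Fin (m + 2), if i = j ∨ ((i : ℕ) < 2 ∧ (j : ℕ) < 2) then 0 else (A i j) ^ 2

lemma offPart_nonneg {m : ℕ} (A : Matrix (Fin (m + 2)) (Fin (m + 2)) ℝ) : 0 ≤ offPart A := by
  unfold offPart
  refine Finset.sum_nonneg fun i _ => Finset.sum_nonneg fun j _ => ?_
  split_ifs
  · exact le_rfl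
  · positivity

lemma offPart_eq_zero {m : ℕ} (A : Matrix (Fin (m + 2)) (Fin (m + 2)) ℝ) :
    offPart A = 0 ↔ ∀ i j : Fin (m + 2), i ≠ j → ¬ ((i : ℕ) < 2 ∧ (j : ℕ) < 2) → A i j = 0 := by
  have nn : ∀ i j : Fin (m + 2),
      0 ≤ (if i = j ∨ ((i : ℕ) < 2 ∧ (j : ℕ) < 2) then 0 else (A i j) ^ 2) := by
    intro i j
    split_ifs
    · exact le_rfl
    · positivity
  unfold offPart
  rw [Finset.sum_eq_zero_iff_of_nonneg (fun i _ => Finset.sum_nonneg fun j _ => nn i j)]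
  constructor
  · intro H i j hij hb
    have h1 := H i (Finset.mem_univ _)
    rw [Finset.sum_eq_zero_iff_of_nonneg (fun j _ => nn i j)] at h1
    have h2 := h1 j (Finset.mem_univ _)
    rw [if_neg (by tauto)] at h2
    exact pow_eq_zero_iff (two_ne_zero) |>.1 h2
  · intro H i _
    refine Finset.sum_eq_zero fun j _ => ?_
    split_ifs with hc
    · rfl
    · push Not at hc
      rw [H i j hc.1 (by have := hc.2; omega)]
      norm_num

lemma sq_decomp {m : ℕ} (A : Matrix (Fin (m + 2)) (Fin (m + 2)) ℝ) (hA : A.IsSymm) :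
    (∑ i, ∑ j, (A i j) ^ 2) + 2 * (A 0 0 * A 1 1 - (A 0 1) ^ 2) =
      (A 0 0 + A 1 1) ^ 2 + (∑ j : Fin m, (A j.succ.succ j.succ.succ) ^ 2) + offPart A := by
  have e : (∑ i, ∑ j, (A i j) ^ 2) = offPart A +
      ∑ i : Fin (m + 2), ∑ j : Fin (m + 2),
        if i = j ∨ ((i : ℕ) < 2 ∧ (j : ℕ) < 2) then (A i j) ^ 2 else 0 := by
    unfold offPart
    rw [← Finset.sum_add_distrib]
    refine Finset.sum_congr rfl fun i _ => ?_
    rw [← Finset.sum_add_distrib]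
    refine Finset.sum_congr rfl fun j _ => ?_
    split_ifs <;> simp
  have hs : A 1 0 = A 0 1 := hA.apply 0 1
  have e2 : (∑ i : Fin (m + 2), ∑ j : Fin (m + 2),
        if i = j ∨ ((i : ℕ) < 2 ∧ (j : ℕ) < 2) then (A i j) ^ 2 else 0) =
      (A 0 0) ^ 2 + (A 0 1) ^ 2 + ((A 1 0) ^ 2 + (A 1 1) ^ 2) +
        ∑ j : Fin m, (A j.succ.succ j.succ.succ) ^ 2 := by
    simp only [Fin.sum_univ_succ (n := m + 1), Fin.sum_univ_succ (n := m)]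
    have c1 : ∀ x : Fin m, ¬ ((0 : Fin (m + 2)) = x.succ.succ) := fun x => (Fin.succ_ne_zero _).symm
    have c3 : ∀ x : Fin m, ¬ (x.succ.succ = (0 : Fin (m + 2))) := fun x => Fin.succ_ne_zero _
    have c2 : ∀ x : Fin m, ¬ ((1 : Fin (m + 2)) = x.succ.succ) := fun x hx => by
      have := congrArg Fin.val hx
      simp at this
    have c4 : ∀ x : Fin m, ¬ (x.succ.succ = (1 : Fin (m + 2))) := fun x hx => c2 x hx.symm
    simp [c1, c2, c3, c4]
    ring
  rw [e, e2, hs]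
  ring

lemma mean_decomp {m : ℕ} (a : ℝ) (d : Fin m → ℝ) (μ : ℝ)
    (hμ : a + ∑ j, d j = ((m : ℝ) + 1) * μ) :
    a ^ 2 + ∑ j, (d j) ^ 2 - ((m : ℝ) + 1) * μ ^ 2 = (a - μ) ^ 2 + ∑ j, (d j - μ) ^ 2 := by
  have : ∑ j, (d j - μ) ^ 2 = ∑ j, (d j) ^ 2 - 2 * μ * ∑ j, d j + m * μ ^ 2 := by
    simp only [sub_sq, Finset.sum_add_distrib, Finset.sum_sub_distrib, Finset.mul_sum]
    simp
    refine Finset.sum_congr rfl fun j _ => by ring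
  rw [this]
  have h2 : ∑ j, d j = ((m : ℝ) + 1) * μ - a := by linarith
  rw [h2]
  ring


/-- Equality case of the algebraic core of the basic inequality: for symmetric
real `(n+1)×(n+1)` matrices `h¹, …, hᵏ` (`n ≥ 2`, `k ≥ 1`) and a real `ρ` with
`(∑ᵢ h¹ᵢᵢ)² = n (∑ᵣ ∑ᵢⱼ (hʳᵢⱼ)² + ρ)`, the equality
`∑ᵣ (hʳ₁₁ hʳ₂₂ − (hʳ₁₂)²) = ρ / 2` holds iff
(i) `h¹₁₁ + h¹₂₂ = h¹ⱼⱼ` for all `3 ≤ j ≤ n+1`,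
(ii) `h¹ᵢⱼ = 0` for all `i < j` with `(i,j) ≠ (1,2)`, and
(iii) for every `2 ≤ r ≤ k`, `hʳ₁₁ + hʳ₂₂ = 0` and `hʳᵢⱼ = 0` whenever
`i ≥ 3` or `j ≥ 3`.  (Indices are shifted down by one.) -/
theorem basic_inequality_algebraic_core_equality (n k : ℕ) (hn : 2 ≤ n) (hk : 1 ≤ k)
    (h : Fin k → Matrix (Fin (n + 1)) (Fin (n + 1)) ℝ)
    (hsymm : ∀ r, (h r).IsSymm) (ρ : ℝ)
    (htrace : (∑ i, h ⟨0, hk⟩ i i) ^ 2 =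
      n * ((∑ r, ∑ i, ∑ j, (h r i j) ^ 2) + ρ)) :
    (∑ r, (h r 0 0 * h r 1 1 - (h r 0 1) ^ 2) = ρ / 2) ↔
      ((∀ j : Fin (n + 1), 2 ≤ (j : ℕ) →
          h ⟨0, hk⟩ 0 0 + h ⟨0, hk⟩ 1 1 = h ⟨0, hk⟩ j j) ∧
        (∀ i j : Fin (n + 1), i < j → ¬(i = 0 ∧ j = 1) → h ⟨0, hk⟩ i j = 0) ∧
        (∀ r : Fin k, 1 ≤ (r : ℕ) →
          h r 0 0 + h r 1 1 = 0 ∧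
            ∀ i j : Fin (n + 1), 2 ≤ (i : ℕ) ∨ 2 ≤ (j : ℕ) → h r i j = 0)) := by
  obtain ⟨m, rfl⟩ : ∃ m, n = m + 1 := ⟨n - 1, by omega⟩
  obtain ⟨K, rfl⟩ : ∃ K, k = K + 1 := ⟨k - 1, by omega⟩
  have hz : (⟨0, hk⟩ : Fin (K + 1)) = 0 := rfl
  rw [hz] at htrace ⊢
  have hm : ((m : ℝ) + 1) ≠ 0 := by positivity
  obtain ⟨μ, hμ⟩ : ∃ μ : ℝ, ∑ i, h 0 i i = ((m : ℝ) + 1) * μ :=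
    ⟨(∑ i, h 0 i i) / ((m : ℝ) + 1), by field_simp⟩
  have hρ : ρ = ((m : ℝ) + 1) * μ ^ 2 - ∑ r, ∑ i, ∑ j, (h r i j) ^ 2 := by
    rw [hμ] at htrace
    push_cast at htrace
    have : ((m : ℝ) + 1) * (((m : ℝ) + 1) * μ ^ 2) =
        ((m : ℝ) + 1) * ((∑ r, ∑ i, ∑ j, (h r i j) ^ 2) + ρ) := by
      rw [← htrace]
      ring
    have := mul_left_cancel₀ hm this
    linarith
  have hT : (h 0 0 0 + h 0 1 1) + ∑ j : Fin m, h 0 j.succ.succ j.succ.succ =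
      ((m : ℝ) + 1) * μ := by
    rw [← hμ, Fin.sum_univ_succ, Fin.sum_univ_succ, ← add_assoc]
    rfl
  have hmean := mean_decomp _ _ _ hT
  have hsum : (∑ r, ∑ i, ∑ j, (h r i j) ^ 2) +
      2 * ∑ r, (h r 0 0 * h r 1 1 - (h r 0 1) ^ 2) =
      ∑ r, ((h r 0 0 + h r 1 1) ^ 2 + (∑ j : Fin m, (h r j.succ.succ j.succ.succ) ^ 2)
        + offPart (h r)) := by
    rw [Finset.mul_sum, ← Finset.sum_add_distrib]
    exact Finset.sum_congr rfl fun r _ => sq_decomp (h r) (hsymm r)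
  rw [Fin.sum_univ_succ (f := fun r => ((h r 0 0 + h r 1 1) ^ 2 +
    (∑ j : Fin m, (h r j.succ.succ j.succ.succ) ^ 2) + offPart (h r)))] at hsum
  have n1 : ∀ r, 0 ≤ ∑ j : Fin m, (h r j.succ.succ j.succ.succ) ^ 2 :=
    fun r => Finset.sum_nonneg fun j _ => sq_nonneg _
  have n2 : 0 ≤ ∑ j : Fin m, (h 0 j.succ.succ j.succ.succ - μ) ^ 2 :=
    Finset.sum_nonneg fun j _ => sq_nonneg _
  have n3 : ∀ r, 0 ≤ (h r 0 0 + h r 1 1) ^ 2 +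
      (∑ j : Fin m, (h r j.succ.succ j.succ.succ) ^ 2) + offPart (h r) := fun r =>
    add_nonneg (add_nonneg (sq_nonneg _) (n1 r)) (offPart_nonneg _)
  have n4 := Finset.sum_nonneg (s := Finset.univ) (fun (r : Fin K) _ => n3 r.succ)
  have n5 := offPart_nonneg (h 0)
  have n6 := sq_nonneg (h 0 0 0 + h 0 1 1 - μ)
  have idx : ∀ j : Fin (m + 1 + 1), 2 ≤ (j : ℕ) → ∃ l : Fin m, j = l.succ.succ := by
    intro j hj
    refine ⟨⟨j - 2, by omega⟩, ?_⟩
    apply Fin.ext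
    simp
    omega
  constructor
  · intro heq
    rw [heq] at hsum
    have z1 : (h 0 0 0 + h 0 1 1 - μ) ^ 2 = 0 := by linarith
    have z2 : ∑ j : Fin m, (h 0 j.succ.succ j.succ.succ - μ) ^ 2 = 0 := by linarith
    have z3 : offPart (h 0) = 0 := by linarith
    have z4 : ∑ r : Fin K, ((h r.succ 0 0 + h r.succ 1 1) ^ 2 +
      (∑ j : Fin m, (h r.succ j.succ.succ j.succ.succ) ^ 2) + offPart (h r.succ)) = 0 := by
      linarith
    rw [Finset.sum_eq_zero_iff_of_nonneg (fun j _ => sq_nonneg _)] at z2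
    rw [Finset.sum_eq_zero_iff_of_nonneg (fun j _ => n3 _)] at z4
    rw [offPart_eq_zero] at z3
    have z1' := pow_eq_zero_iff (two_ne_zero) |>.1 z1
    refine ⟨?_, ?_, ?_⟩
    · intro j hj
      obtain ⟨l, rfl⟩ := idx j hj
      have := pow_eq_zero_iff (two_ne_zero) |>.1 (z2 l (Finset.mem_univ _))
      linarith
    · intro i j hij hne
      refine z3 i j hij.ne fun hb => hne ?_
      have : (i : ℕ) < j := hij
      constructor
      · apply Fin.ext
        change (i : ℕ) = 0
        omega
      · apply Fin.ext
        have h11 : ((1 : Fin (m + 1 + 1)) : ℕ) = 1 := by simp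
        rw [h11]
        omega
    · intro r hr
      obtain ⟨s, rfl⟩ := Fin.exists_succ_eq.2 (show r ≠ 0 by rintro rfl; simp at hr)
      have w := z4 s (Finset.mem_univ _)
      have w1 := n1 s.succ
      have w2 := offPart_nonneg (h s.succ)
      have w3 := sq_nonneg (h s.succ 0 0 + h s.succ 1 1)
      have y1 : (h s.succ 0 0 + h s.succ 1 1) ^ 2 = 0 := by linarith
      have y2 : ∑ j : Fin m, (h s.succ j.succ.succ j.succ.succ) ^ 2 = 0 := by linarith
      have y3 : offPart (h s.succ) = 0 := by linarith
      rw [Finset.sum_eq_zero_iff_of_nonneg (fun j _ => sq_nonneg _)] at y2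
      rw [offPart_eq_zero] at y3
      refine ⟨pow_eq_zero_iff (two_ne_zero) |>.1 y1, ?_⟩
      intro i j hij
      by_cases e : i = j
      · subst e
        obtain ⟨l, rfl⟩ := idx i (by omega)
        exact pow_eq_zero_iff (two_ne_zero) |>.1 (y2 l (Finset.mem_univ _))
      · exact y3 i j e (by omega)
  · rintro ⟨h1, h2, h3⟩
    have hd : ∀ l : Fin m, h 0 l.succ.succ l.succ.succ = h 0 0 0 + h 0 1 1 := fun l =>
      (h1 _ (by simp)).symm
    have ha : h 0 0 0 + h 0 1 1 = μ := by
      simp only [hd] at hT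
      simp at hT
      apply mul_left_cancel₀ hm
      linarith
    have z2 : ∑ j : Fin m, (h 0 j.succ.succ j.succ.succ - μ) ^ 2 = 0 :=
      Finset.sum_eq_zero fun j _ => by rw [hd, ha]; ring
    have z3 : offPart (h 0) = 0 := by
      rw [offPart_eq_zero]
      intro i j hij hb
      rcases lt_or_gt_of_ne hij with hl | hl
      · exact h2 i j hl (by rintro ⟨rfl, rfl⟩; simp at hb)
      · rw [← (hsymm 0).apply]
        exact h2 j i hl (by rintro ⟨rfl, rfl⟩; simp at hb)
    have z4 : ∑ r : Fin K, ((h r.succ 0 0 + h r.succ 1 1) ^ 2 +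
      (∑ j : Fin m, (h r.succ j.succ.succ j.succ.succ) ^ 2) + offPart (h r.succ)) = 0 := by
      refine Finset.sum_eq_zero fun r _ => ?_
      obtain ⟨g1, g2⟩ := h3 r.succ (by simp)
      rw [g1, (offPart_eq_zero _).2 (fun i j _ hb => g2 i j (by omega)),
        Finset.sum_eq_zero fun j _ => by rw [g2 _ _ (Or.inl (by simp))]; norm_num]
      norm_num
    have z1 : (h 0 0 0 + h 0 1 1 - μ) ^ 2 = 0 := by rw [ha]; ring
    linarith
end

section
/- Let n ≥ 2 and k ≥ 1 be integers and let c, p, a, b be real numbers. For each r = 1, …, k let h^r = (h^r_{ij})_{1 ≤ i,j ≤ n+1} be a symmetric real (n+1)×(n+1) matrix, and assume Σ_{i=1}^{n+1} h^r_{ii} = 0 for every r ≥ 2. Define H² = (1/(n+1)²)·Σ_{r=1}^{k} (Σ_{i=1}^{n+1} h^r_{ii})², ‖h‖² = Σ_{r=1}^{k} Σ_{i,j=1}^{n+1} (h^r_{ij})², τ = (1/2)·( (c/4)·(3p + n(n−1)) + (n+1)²·H² − ‖h‖² ), and K = (c/4)·(1 + 3a − b) + Σ_{r=1}^{k} ( h^r_{11}·h^r_{22}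 − (h^r_{12})² ). Then τ − K ≤ ((n+1)²(n−1)/(2n))·H² + (c/8)·( 3p − 6a + 2b + (n+1)(n−2) ). -/
theorem bi_aux (m : ℕ) (A : Matrix (Fin (m + 2)) (Fin (m + 2)) ℝ) (hA : A.IsSymm) :
    (∑ i, A i i) ^ 2 ≤ ((m : ℝ) + 1) *
      ((∑ i, ∑ j, (A i j) ^ 2) + 2 * (A 0 0 * A 1 1 - (A 0 1) ^ 2)) := by
  have h10 : A 1 0 = A 0 1 := hA.apply 0 1
  have hc := sq_sum_le_card_mul_sum_sq (s := (Finset.univ : Finset (Fin (m + 1))))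
    (f := Fin.cons (A 0 0 + A 1 1) (fun i : Fin m => A i.succ.succ i.succ.succ))
  simp only [Fin.sum_univ_succ (n := m), Fin.cons_zero, Fin.cons_succ, Finset.card_univ,
    Fintype.card_fin, Nat.cast_add, Nat.cast_one] at hc
  have hT : ∑ i, A i i = A 0 0 + A 1 1 + ∑ i : Fin m, A i.succ.succ i.succ.succ := by
    rw [Fin.sum_univ_succ, Fin.sum_univ_succ, Fin.succ_zero_eq_one]
    ring
  have hrow : ∀ i, A i 0 ^ 2 + A i 1 ^ 2 ≤ ∑ j, (A i j) ^ 2 := by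
    intro i
    rw [Fin.sum_univ_succ, Fin.sum_univ_succ, Fin.succ_zero_eq_one]
    have : 0 ≤ ∑ j : Fin m, A i j.succ.succ ^ 2 := Finset.sum_nonneg fun _ _ => sq_nonneg _
    linarith
  have hrest : ∑ i : Fin m, A i.succ.succ i.succ.succ ^ 2
      ≤ ∑ i : Fin m, ∑ j, A i.succ.succ j ^ 2 :=
    Finset.sum_le_sum fun i _ =>
      Finset.single_le_sum (f := fun j => A i.succ.succ j ^ 2)
        (fun _ _ => sq_nonneg _) (Finset.mem_univ _)
  have hN : ∑ i, ∑ j, (A i j) ^ 2 = ∑ j, (A 0 j) ^ 2 + ∑ j, (A 1 j) ^ 2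
      + ∑ i : Fin m, ∑ j, A i.succ.succ j ^ 2 := by
    rw [Fin.sum_univ_succ (n := m + 1), Fin.sum_univ_succ (n := m), Fin.succ_zero_eq_one]
    ring
  rw [hT]
  refine hc.trans (mul_le_mul_of_nonneg_left ?_ (by positivity))
  have h0 := hrow 0
  have h1 := hrow 1
  rw [h10] at h1
  rw [hN]
  nlinarith


/-- Coordinate form of the basic inequality for submanifolds of a cosymplectic
space form: with `h¹, …, hᵏ` symmetric real `(n+1)×(n+1)` matrices (`n ≥ 2`,
`k ≥ 1`), traceless for `r ≥ 2`, and with `H²`, `‖h‖²`, `τ`, `K` defined as in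
the Gauss equation, one has
`τ − K ≤ ((n+1)²(n−1)/(2n))·H² + (c/8)(3p − 6a + 2b + (n+1)(n−2))`. -/
theorem basic_inequality_coordinates (n k : ℕ) (hn : 2 ≤ n) (hk : 1 ≤ k)
    (c p a b : ℝ)
    (h : Fin k → Matrix (Fin (n + 1)) (Fin (n + 1)) ℝ)
    (hsymm : ∀ r, (h r).IsSymm)
    (htraceless : ∀ r : Fin k, 1 ≤ (r : ℕ) → ∑ i, h r i i = 0)
    (H2 hnorm2 τ K : ℝ)
    (hH2 : H2 = (1 / ((n : ℝ) + 1) ^ 2) * ∑ r, (∑ i, h r i i) ^ 2)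
    (hhnorm2 : hnorm2 = ∑ r, ∑ i, ∑ j, (h r i j) ^ 2)
    (hτ : τ = (1 / 2) *
      ((c / 4) * (3 * p + (n : ℝ) * ((n : ℝ) - 1)) + ((n : ℝ) + 1) ^ 2 * H2 - hnorm2))
    (hK : K = (c / 4) * (1 + 3 * a - b) +
      ∑ r, (h r 0 0 * h r 1 1 - (h r 0 1) ^ 2)) :
    τ - K ≤ (((n : ℝ) + 1) ^ 2 * ((n : ℝ) - 1) / (2 * (n : ℝ))) * H2 +
      (c / 8) * (3 * p - 6 * a + 2 * b + ((n : ℝ) + 1) * ((n : ℝ) - 2)) := by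
  obtain ⟨m, rfl⟩ : ∃ m, n = m + 1 := ⟨n - 1, by omega⟩
  have key := Finset.sum_le_sum fun r (_ : r ∈ (Finset.univ : Finset (Fin k))) =>
    bi_aux m (h r) (hsymm r)
  rw [← Finset.mul_sum, Finset.sum_add_distrib, ← Finset.mul_sum, ← hhnorm2] at key
  have hpos : (0 : ℝ) < (m : ℝ) + 1 := by positivity
  have hT : ∑ r, (∑ i, h r i i) ^ 2 = (((m + 1 : ℕ) : ℝ) + 1) ^ 2 * H2 := by
    rw [hH2]
    field_simp
  rw [hT, ← div_le_iff₀' hpos] at key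
  rw [hτ, hK]
  push_cast at key ⊢
  generalize ∑ r, (h r 0 0 * h r 1 1 - (h r 0 1) ^ 2) = S at key ⊢
  have e : ((m : ℝ) + 1 + 1) ^ 2 * ((m : ℝ) + 1 - 1) / (2 * ((m : ℝ) + 1)) * H2
      = (((m : ℝ) + 1 + 1) ^ 2 * H2) / 2
        - (((m : ℝ) + 1 + 1) ^ 2 * H2 / ((m : ℝ) + 1)) / 2 := by
    field_simp
  rw [e]
  linarith
end

section
/- Let n ≥ 1, let V be an (n+1)-dimensional real inner product space, let ξ ∈ V be a unit vector, and let P : V → V be a linear map such that ‖P v‖² ≤ ‖v‖² − ⟨ξ, v⟩² for every v ∈ V. Then for every orthonormal basis (e_1, …, e_{n+1}) of V with n+1 ≥ 2, 3·Σ_{i,j=1}^{n+1} ⟨e_i, P e_j⟩² − 6·⟨e_1, P e_2⟩² + 2·(⟨ξ, e_1⟩² + ⟨ξ, e_2⟩²) ≤ 3n + 2. -/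
open scoped RealInnerProductSpace

/-- If `V` is an `(n+1)`-dimensional real inner product space (`n ≥ 1`),
`ξ ∈ V` a unit vector, and `P : V → V` linear with `‖P v‖² ≤ ‖v‖² − ⟪ξ, v⟫²`,
then for every orthonormal basis `e₁, …, e_{n+1}` of `V`:
`3 ∑ᵢⱼ ⟪eᵢ, P eⱼ⟫² − 6 ⟪e₁, P e₂⟫² + 2 (⟪ξ, e₁⟫² + ⟪ξ, e₂⟫²) ≤ 3n + 2`. -/
theorem max_bound {V : Type*} [NormedAddCommGroup V] [InnerProductSpace ℝ V]
    [FiniteDimensional ℝ V] (n : ℕ) (hn : 1 ≤ n)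
    (hdim : Module.finrank ℝ V = n + 1)
    (ξ : V) (hξ : ‖ξ‖ = 1) (P : V →ₗ[ℝ] V)
    (hP : ∀ v : V, ‖P v‖ ^ 2 ≤ ‖v‖ ^ 2 - ⟪ξ, v⟫ ^ 2)
    (e : OrthonormalBasis (Fin (n + 1)) ℝ V) :
    3 * (∑ i, ∑ j, ⟪e i, P (e j)⟫ ^ 2) - 6 * ⟪e 0, P (e 1)⟫ ^ 2 +
        2 * (⟪ξ, e 0⟫ ^ 2 + ⟪ξ, e 1⟫ ^ 2) ≤ 3 * (n : ℝ) + 2 := by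
  have key : ∀ x : V, ∑ i, ⟪e i, x⟫ ^ 2 = ‖x‖ ^ 2 := by
    intro x
    rw [← e.sum_sq_norm_inner_right x]
    simp
  have hxi : ∑ j, ⟪ξ, e j⟫ ^ 2 = 1 := by
    have h := key ξ
    rw [hξ] at h
    simpa [real_inner_comm] using h
  have hsum : ∑ i, ∑ j, ⟪e i, P (e j)⟫ ^ 2 ≤ (n : ℝ) := by
    rw [Finset.sum_comm]
    have h1 : ∑ j, ∑ i, ⟪e i, P (e j)⟫ ^ 2 ≤ ∑ j, (1 - ⟪ξ, e j⟫ ^ 2) := by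
      refine Finset.sum_le_sum fun j _ => ?_
      rw [key]
      simpa using hP (e j)
    rw [Finset.sum_sub_distrib, hxi] at h1
    simpa using h1
  have h01 : (0 : Fin (n + 1)) ≠ 1 := by
    obtain ⟨m, rfl⟩ : ∃ m, n = m + 1 := ⟨n - 1, by omega⟩
    simp
  have hb : ⟪ξ, e 0⟫ ^ 2 + ⟪ξ, e 1⟫ ^ 2 ≤ 1 := by
    rw [← hxi, ← Finset.sum_pair (f := fun j => ⟪ξ, e j⟫ ^ 2) h01]
    exact Finset.sum_le_sum_of_subset_of_nonneg (Finset.subset_univ _)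
      fun j _ _ => sq_nonneg _
  nlinarith [sq_nonneg (⟪e 0, P (e 1)⟫ : ℝ)]
end

section
/- Let V be a finite-dimensional real inner product space, let ξ ∈ V be a unit vector, and let φ : V → V be a skew-adjoint linear endomorphism (⟨φ v, w⟩ = −⟨v, φ w⟩ for all v, w) satisfying φ(φ(v)) = −v + ⟨v, ξ⟩·ξ for all v ∈ V. Let e ∈ V be a unit vector orthogonal to ξ, and let A : V → V be a self-adjoint linear endomorphism such that A∘φ + φ∘A = 0, A ξ = 0, and A v = 0 for every v ∈ V orthogonal to both ξ and e. Then A = 0. -/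
open scoped RealInnerProductSpace

/-- Totally geodesic step: if `(φ, ξ)` is an almost contact structure at a
point (`φ` skew-adjoint, `φ² = −id + ⟨·, ξ⟩ ξ`, `‖ξ‖ = 1`), `e` is a unit
vector orthogonal to `ξ`, and `A` is a self-adjoint endomorphism that
anticommutes with `φ`, annihilates `ξ`, and annihilates every vector
orthogonal to both `ξ` and `e`, then `A = 0`. -/
theorem shape_operator_vanishes {V : Type*} [NormedAddCommGroup V]
    [InnerProductSpace ℝ V] [FiniteDimensional ℝ V]
    (ξ : V) (hξ : ‖ξ‖ = 1) (φ : V →ₗ[ℝ] V)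
    (hφskew : ∀ v w : V, ⟪φ v, w⟫ = -⟪v, φ w⟫)
    (hφsq : ∀ v : V, φ (φ v) = -v + ⟪v, ξ⟫ • ξ)
    (e : V) (he : ‖e‖ = 1) (heξ : ⟪e, ξ⟫ = 0)
    (A : V →ₗ[ℝ] V) (hAsym : ∀ v w : V, ⟪A v, w⟫ = ⟪v, A w⟫)
    (hanti : A ∘ₗ φ + φ ∘ₗ A = 0)
    (hAξ : A ξ = 0)
    (hA0 : ∀ v : V, ⟪v, ξ⟫ = 0 → ⟪v, e⟫ = 0 → A v = 0) :
    A = 0 := by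
  have hξξ : ⟪ξ, ξ⟫ = 1 := by rw [real_inner_self_eq_norm_sq, hξ]; norm_num
  have hee : ⟪e, e⟫ = 1 := by rw [real_inner_self_eq_norm_sq, he]; norm_num
  have hφξ : φ ξ = 0 := by
    have h : ⟪φ ξ, φ ξ⟫ = 0 := by
      rw [hφskew, hφsq, hξξ]; simp
    exact inner_self_eq_zero.mp h
  have h1 : ⟪φ e, ξ⟫ = 0 := by rw [hφskew, hφξ]; simp
  have h2 : ⟪φ e, e⟫ = 0 := by
    have h := hφskew e e
    rw [real_inner_comm (φ e) e] at h
    linarith [real_inner_comm (φ e) e]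
  have h3 : A (φ e) = 0 := hA0 _ h1 h2
  have h4 : φ (A e) = 0 := by
    have h := LinearMap.congr_fun hanti e
    simpa [h3] using h
  have hAe : A e = 0 := by
    have h := hφsq (A e)
    rw [h4, hAsym, hAξ] at h
    simpa using h
  ext v
  have h5 := hA0 (v - ⟪v, ξ⟫ • ξ - ⟪v, e⟫ • e)
    (by simp only [inner_sub_left, real_inner_smul_left, hξξ, heξ]; ring)
    (by simp only [inner_sub_left, real_inner_smul_left, hee, real_inner_comm e ξ, heξ]; ring)
  simpa [hAξ, hAe] using h5
end
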